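/- arXiv:1906.04502 — 2 statements merged into one kernel-verified Lean document; each statement's English description precedes it below -/
import Mathlib

section
/- For every α with 0 < α ≤ 1/2 and every γ ∈ [0,1], R_SM(α,γ) ≥ R_SSM(α,γ), where R_SM(α,γ) = (α(1-α)²(4α + γ(1-2α)) - α³)/(1 - α(1 + (2-α)α)) and R_SSM(α,γ) = α(α(α(2α-5) + 4) - (α-1)³γ)/((α-1)α² + 1). -/
/-- Eyal–Sirer relative revenue of a single selfish miner with hash power α and
propagation γ. -/
noncomputable def R_SM (α γ : ℝ) : ℝ :=
  (α * (1 - α) ^ 2 * (4 * α + γ * (1 - 2 * α)) - α ^ 3) /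
    (1 - α * (1 + (2 - α) * α))

/-- Relative revenue of a single SSM miner with hash power α and propagation γ. -/
noncomputable def R_SSM (α γ : ℝ) : ℝ :=
  α * (α * (α * (2 * α - 5) + 4) - (α - 1) ^ 3 * γ) / ((α - 1) * α ^ 2 + 1)

theorem R_SM_ge_R_SSM (α γ : ℝ) (hα0 : 0 < α) (hα : α ≤ 1 / 2)
    (hγ0 : 0 ≤ γ) (hγ1 : γ ≤ 1) :
    R_SM α γ ≥ R_SSM α γ := by
  have hsq : α ^ 2 ≤ 1 / 4 := by nlinarith
  have hcube : 0 < α ^ 3 := by positivity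
  have hSM : 0 < 1 - α * (1 + (2 - α) * α) := by nlinarith
  have hSSM : 0 < (α - 1) * α ^ 2 + 1 := by nlinarith
  have hgap : 0 ≤ α ^ 4 * ((1 - 2 * α ^ 2 + α ^ 3) + (1 - γ) * (α * (1 - α) ^ 2)) := by
    have h₁ : 0 ≤ 1 - 2 * α ^ 2 + α ^ 3 := by linarith
    have h₂ : 0 ≤ 1 - γ := by linarith
    positivity
  unfold R_SM R_SSM
  rw [ge_iff_le, div_le_div_iff₀ hSSM hSM]
  linear_combination hgap
end

section
/- Let α₁, α₂ ∈ (0, 1/2] with α₁ + α₂ < 1 and β = 1 - α₁ - α₂ > 0, and let P be the 9×9 transition matrix of the two-SSM-miner Markov chain (with columns indexed by states S₀₀, S₀₁, S₁₀, S₀₂, S₁₁, S₂₀, S₁₂, S₂₁, S₂₂, and rows [β,β,β,β,β,β, α₂(1-α₂)+β, α₁(1-α₁)+β, 1], [α₂,0,0,0,0,0,0,0,0], [α₁,0,0,0,0,0,0,0,0], [0,α₂,0,α₂,0,0,α₂²,0,0], [0,α₁,α₂,0,0,0,0,0,0], [0,0,α₁,0,0,α₁,0,α₁²,0], [0,0,0,α₁,α₂,0,0,0,0],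 [0,0,0,0,α₁,α₂,0,0,0], [0,0,0,0,0,0,α₁,α₂,0]). Then there exists exactly one probability vector π ∈ ℝ⁹ (entries nonnegative, summing to 1) with P·π = π. -/
/-- Transition matrix of the two-SSM-miner Markov chain, with states ordered
S₀₀, S₀₁, S₁₀, S₀₂, S₁₁, S₂₀, S₁₂, S₂₁, S₂₂; column `y` gives the distribution
of the next state conditioned on the current state `y`. -/
def twoSSMMatrix (α₁ α₂ : ℝ) : Matrix (Fin 9) (Fin 9) ℝ :=
  let β := 1 - α₁ - α₂
  Matrix.of
    ![![β, β, β, β, β, β, α₂ * (1 - α₂) + β, α₁ * (1 - α₁) + β, 1],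
      ![α₂, 0, 0, 0, 0, 0, 0, 0, 0],
      ![α₁, 0, 0, 0, 0, 0, 0, 0, 0],
      ![0, α₂, 0, α₂, 0, 0, α₂ ^ 2, 0, 0],
      ![0, α₁, α₂, 0, 0, 0, 0, 0, 0],
      ![0, 0, α₁, 0, 0, α₁, 0, α₁ ^ 2, 0],
      ![0, 0, 0, α₁, α₂, 0, 0, 0, 0],
      ![0, 0, 0, 0, α₁, α₂, 0, 0, 0],
      ![0, 0, 0, 0, 0, 0, α₁, α₂, 0]]

/-- The invariant measure of the two-SSM-miner chain, normalised to give `S₀₀` mass one. -/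
noncomputable def twoSSMWeight (a b : ℝ) : Fin 9 → ℝ :=
  let w₀₂ := (b ^ 2 + 2 * a * b ^ 4) / (1 - b - a * b ^ 2)
  let w₂₀ := (a ^ 2 + 2 * b * a ^ 4) / (1 - a - b * a ^ 2)
  let w₁₂ := a * w₀₂ + 2 * a * b ^ 2
  let w₂₁ := 2 * a ^ 2 * b + b * w₂₀
  ![1, b, a, w₀₂, 2 * a * b, w₂₀, w₁₂, w₂₁, a * w₁₂ + b * w₂₁]

theorem twoSSM_denominator_pos {a b : ℝ} (ha : 0 < a) (hb : 0 < b) (hb' : b ≤ 1 / 2)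
    (hsum : a + b < 1) : 0 < 1 - b - a * b ^ 2 := by
  have h : b ^ 2 < 1 := by nlinarith
  nlinarith

theorem twoSSMWeight_nonneg {a b : ℝ} (ha : 0 < a) (ha' : a ≤ 1 / 2) (hb : 0 < b)
    (hb' : b ≤ 1 / 2) (hsum : a + b < 1) (i : Fin 9) : 0 ≤ twoSSMWeight a b i := by
  have h₁ := twoSSM_denominator_pos ha hb hb' hsum
  have h₂ := twoSSM_denominator_pos hb ha ha' (by linarith)
  fin_cases i <;> simp [twoSSMWeight] <;> positivity

/-- The stationarity equations, with that of `S₀₀` replaced by the trivial one: it follows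
from the others because the columns sum to one. -/
theorem twoSSMMatrix_mulVec_eq_iff (a b : ℝ) (v : Fin 9 → ℝ) :
    (twoSSMMatrix a b).mulVec v = v ↔
      v 1 = b * v 0 ∧ v 2 = a * v 0 ∧ v 3 = b * v 1 + b * v 3 + b ^ 2 * v 6 ∧
        v 4 = a * v 1 + b * v 2 ∧ v 5 = a * v 2 + a * v 5 + a ^ 2 * v 7 ∧
        v 6 = a * v 3 + b * v 4 ∧ v 7 = a * v 4 + b * v 5 ∧ v 8 = a * v 6 + b * v 7 := by
  simp only [funext_iff, Fin.forall_fin_succ, twoSSMMatrix, Matrix.mulVec, dotProduct,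
    Fin.sum_univ_succ]
  simp [Fin.succ]
  constructor
  · rintro ⟨-, h1, h2, h3, h4, h5, h6, h7, h8⟩
    refine ⟨?_, ?_, ?_, ?_, ?_, ?_, ?_, ?_⟩ <;> linarith
  · rintro ⟨h1, h2, h3, h4, h5, h6, h7, h8⟩
    refine ⟨?_, ?_, ?_, ?_, ?_, ?_, ?_, ?_, ?_⟩ <;> linarith

theorem twoSSMMatrix_mulVec_eq_iff_smul {a b : ℝ} (ha : 1 - a - b * a ^ 2 ≠ 0)
    (hb : 1 - b - a * b ^ 2 ≠ 0) (v : Fin 9 → ℝ) :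
    (twoSSMMatrix a b).mulVec v = v ↔ v = v 0 • twoSSMWeight a b := by
  obtain ⟨x, hx⟩ : ∃ x, x = (b ^ 2 + 2 * a * b ^ 4) / (1 - b - a * b ^ 2) := ⟨_, rfl⟩
  obtain ⟨y, hy⟩ : ∃ y, y = (a ^ 2 + 2 * b * a ^ 4) / (1 - a - b * a ^ 2) := ⟨_, rfl⟩
  have hx' := (eq_div_iff hb).1 hx
  have hy' := (eq_div_iff ha).1 hy
  rw [twoSSMMatrix_mulVec_eq_iff, funext_iff]
  simp only [Fin.forall_fin_succ, twoSSMWeight, ← hx, ← hy]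
  simp [Fin.succ]
  constructor
  · rintro ⟨h1, h2, h3, h4, h5, h6, h7, h8⟩
    have h4' : v 4 = v 0 * (2 * a * b) := by rw [h4, h1, h2]; ring
    have h3' : v 3 = v 0 * x := by
      apply mul_right_cancel₀ hb
      rw [h6, h4', h1] at h3
      linear_combination h3 - v 0 * hx'
    have h5' : v 5 = v 0 * y := by
      apply mul_right_cancel₀ ha
      rw [h7, h4', h2] at h5
      linear_combination h5 - v 0 * hy'
    have h6' : v 6 = v 0 * (a * x + 2 * a * b ^ 2) := by rw [h6, h3', h4']; ring
    have h7' : v 7 = v 0 * (2 * a ^ 2 * b + b * y) := by rw [h7, h5', h4']; ring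
    refine ⟨by linarith, by linarith, h3', h4', h5', h6', h7', ?_⟩
    rw [h8, h6', h7']; ring
  · rintro ⟨h1, h2, h3, h4, h5, h6, h7, h8⟩
    rw [h1, h2, h3, h4, h5, h6, h7, h8]
    refine ⟨by ring, by ring, ?_, by ring, ?_, by ring, by ring, by ring⟩
    · linear_combination v 0 * hx'
    · linear_combination v 0 * hy'

theorem twoSSMMatrix_unique_stationary_distribution (α₁ α₂ : ℝ)
    (h₁0 : 0 < α₁) (h₁ : α₁ ≤ 1 / 2) (h₂0 : 0 < α₂) (h₂ : α₂ ≤ 1 / 2)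
    (hsum : α₁ + α₂ < 1) :
    ∃! π : Fin 9 → ℝ,
      (∀ i, 0 ≤ π i) ∧ (∑ i, π i = 1) ∧
        (twoSSMMatrix α₁ α₂).mulVec π = π := by
  have key := twoSSMMatrix_mulVec_eq_iff_smul
    (twoSSM_denominator_pos h₂0 h₁0 h₁ (by linarith)).ne'
    (twoSSM_denominator_pos h₁0 h₂0 h₂ hsum).ne'
  have hw := twoSSMWeight_nonneg h₁0 h₁ h₂0 h₂ hsum
  have hw0 : twoSSMWeight α₁ α₂ 0 = 1 := rfl
  set w := twoSSMWeight α₁ α₂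
  have hS : 0 < ∑ i, w i :=
    Finset.sum_pos' (fun i _ ↦ hw i) ⟨0, Finset.mem_univ _, by rw [hw0]; exact one_pos⟩
  refine ⟨(∑ i, w i)⁻¹ • w, ⟨fun i ↦ mul_nonneg (inv_nonneg.2 hS.le) (hw i), ?_, ?_⟩, ?_⟩
  · simp only [Pi.smul_apply, smul_eq_mul, ← Finset.mul_sum]
    exact inv_mul_cancel₀ hS.ne'
  · rw [key]
    simp [hw0]
  · rintro v ⟨-, hv, hP⟩
    have hvw := (key v).1 hP
    rw [hvw] at hv
    simp only [Pi.smul_apply, smul_eq_mul, ← Finset.mul_sum] at hv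
    rw [hvw, eq_inv_of_mul_eq_one_left hv]
end
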